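/- For every Schwartz function a ∈ 𝒮(ℝ; ℂ), the function u(t) := 𝐹⁻¹(ξ ↦ e^{itℏξ²/2} (𝐹a)(ξ)) satisfies: u(t) ∈ 𝒮(ℝ; ℂ) for every t ∈ ℝ; the map (t,s) ↦ u(t)(s) is smooth on ℝ²; u(0) = a; and u solves the free Schrödinger equation i ∂_t u(t,s) = (ℏ/2) ∂²_s u(t,s) for all (t,s) ∈ ℝ². (This u(t) is the function denoted e^{−itℏ∂_s²/2} a.) -/

import Mathlib

open MeasureTheory

/-- Fourier transform with the convention `(𝐹a)(ξ) = (2π)^{-1/2} ∫ a(s) e^{-isξ} ds`. -/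
noncomputable def Ftr (a : ℝ → ℂ) (ξ : ℝ) : ℂ :=
  ((Real.sqrt (2 * Real.pi))⁻¹ : ℝ) * ∫ s : ℝ, a s * Complex.exp (-(Complex.I * s * ξ))

/-- Inverse Fourier transform `(𝐹⁻¹b)(s) = (2π)^{-1/2} ∫ b(ξ) e^{isξ} dξ`. -/
noncomputable def Finv (b : ℝ → ℂ) (s : ℝ) : ℂ :=
  ((Real.sqrt (2 * Real.pi))⁻¹ : ℝ) * ∫ ξ : ℝ, b ξ * Complex.exp (Complex.I * s * ξ)

/-- The function `u(t) := 𝐹⁻¹(ξ ↦ e^{itℏξ²/2} (𝐹a)(ξ))`, denoted `e^{-itℏ∂_s²/2} a`. -/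
noncomputable def freeProp (hbar : ℝ) (a : ℝ → ℂ) (t s : ℝ) : ℂ :=
  Finv (fun ξ => Complex.exp (Complex.I * t * hbar * ξ ^ 2 / 2) * Ftr a ξ) s

open scoped FourierTransform SchwartzMap ContDiff

/-- The representation of the propagator as an oscillatory integral. -/
lemma freeProp_eq (hbar : ℝ) (a : SchwartzMap ℝ ℂ) (t s : ℝ) :
    freeProp hbar (⇑a) t s =
      ∫ η : ℝ, Complex.exp (Complex.I * t * (hbar * (2 * Real.pi) ^ 2 / 2 * η ^ 2 : ℝ)) *
        (Complex.exp (Complex.I * s * (2 * Real.pi * η : ℝ)) * (𝓕 a) η) := by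
  have hF : ∀ η : ℝ, Ftr a (2 * Real.pi * η) = ((Real.sqrt (2 * Real.pi))⁻¹ : ℝ) * (𝓕 a) η := by
    intro η
    unfold Ftr
    rw [SchwartzMap.fourier_coe, Real.fourier_real_eq_integral_exp_smul]
    congr 2 with x
    rw [smul_eq_mul, mul_comm]
    congr 2
    push_cast
    ring
  have hpi : (0 : ℝ) < 2 * Real.pi := by positivity
  unfold freeProp Finv
  have h := Measure.integral_comp_mul_left (fun ξ : ℝ =>
    Complex.exp (Complex.I * t * hbar * ξ ^ 2 / 2) * Ftr a ξ * Complex.exp (Complex.I * s * ξ))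
    (2 * Real.pi)
  have h2 : ∀ X Y : ℂ, X = |(2 * Real.pi)⁻¹| • Y → Y = (2 * Real.pi : ℝ) * X := by
    intro X Y e
    rw [e, abs_of_pos (inv_pos.2 hpi), Complex.real_smul, ← mul_assoc, ← Complex.ofReal_mul,
      mul_inv_cancel₀ hpi.ne']
    simp
  rw [h2 _ _ h, ← mul_assoc, ← integral_const_mul]
  congr 1 with η
  rw [hF]
  have h3 : (((Real.sqrt (2 * Real.pi))⁻¹ : ℝ) : ℂ) * ((2 * Real.pi : ℝ) : ℂ) *
      (((Real.sqrt (2 * Real.pi))⁻¹ : ℝ) : ℂ) = 1 := by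
    rw [← Complex.ofReal_mul, ← Complex.ofReal_mul, ← Complex.ofReal_one]
    congr 1
    have := Real.mul_self_sqrt hpi.le
    have h0 : Real.sqrt (2 * Real.pi) ≠ 0 := (Real.sqrt_pos.2 hpi).ne'
    field_simp
    rw [sq, this]
  have e1 : Complex.I * t * hbar * ((2 * Real.pi * η : ℝ) : ℂ) ^ 2 / 2 =
      Complex.I * t * (hbar * (2 * Real.pi) ^ 2 / 2 * η ^ 2 : ℝ) := by
    push_cast; ring
  rw [e1]
  linear_combination (Complex.exp (Complex.I * t * (hbar * (2 * Real.pi) ^ 2 / 2 * η ^ 2 : ℝ)) *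
        (Complex.exp (Complex.I * s * (2 * Real.pi * η : ℝ)) * (𝓕 a) η)) * h3

lemma norm_cexp_phase (x y : ℝ) : ‖Complex.exp (Complex.I * x * y)‖ = 1 := by
  have : Complex.I * x * y = ((x * y : ℝ) : ℂ) * Complex.I := by push_cast; ring
  rw [this, Complex.norm_exp_ofReal_mul_I]

lemma deriv_phase_integral (φ : ℝ → ℝ) (h : ℝ → ℂ) (hφ : Continuous φ) (hh : Continuous h)
    (h1 : Integrable h) (h2 : Integrable (fun η => (φ η : ℂ) * h η)) (x : ℝ) :
    HasDerivAt (fun x : ℝ => ∫ η : ℝ, Complex.exp (Complex.I * x * φ η) * h η)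
      (∫ η : ℝ, Complex.exp (Complex.I * x * φ η) * (Complex.I * φ η * h η)) x := by
  refine (hasDerivAt_integral_of_dominated_loc_of_deriv_le
    (F := fun (x : ℝ) (η : ℝ) => Complex.exp (Complex.I * x * φ η) * h η)
    (F' := fun (x : ℝ) (η : ℝ) => Complex.exp (Complex.I * x * φ η) * (Complex.I * φ η * h η))
    (bound := fun η => ‖(φ η : ℂ) * h η‖) Filter.univ_mem ?_ ?_ ?_ ?_ h2.norm ?_).2
  · exact Filter.Eventually.of_forall fun y => Continuous.aestronglyMeasurable (by fun_prop)
  · refine h1.norm.mono' (Continuous.aestronglyMeasurable (by fun_prop)) ?_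
    exact Filter.Eventually.of_forall fun η => by rw [norm_mul, norm_cexp_phase, one_mul]
  · exact Continuous.aestronglyMeasurable (by fun_prop)
  · refine Filter.Eventually.of_forall fun η y _ => ?_
    rw [norm_mul, norm_cexp_phase, one_mul, mul_assoc, norm_mul, Complex.norm_I, one_mul]
  · refine Filter.Eventually.of_forall fun η y _ => ?_
    have e : HasDerivAt (fun y : ℝ => Complex.I * y * φ η) (Complex.I * φ η) y := by
      have := ((Complex.ofRealCLM.hasDerivAt (x := y)).const_mul Complex.I).mul_const (φ η : ℂ)
      simpa using this
    have := e.cexp.mul_const (h η)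
    rw [mul_assoc (Complex.exp _)] at this
    convert this using 1

lemma temperate_cexp : Function.HasTemperateGrowth (fun x : ℝ => Complex.exp (Complex.I * x)) := by
  refine ⟨Complex.contDiff_exp.comp (contDiff_const.mul Complex.ofRealCLM.contDiff), fun n => ⟨0, 1, fun x => ?_⟩⟩
  have : ∀ n : ℕ, iteratedDeriv n (fun x : ℝ => Complex.exp (Complex.I * x)) =
      fun x : ℝ => Complex.I ^ n * Complex.exp (Complex.I * x) := by
    intro n
    induction n with
    | zero => simp
    | succ n ih =>
      rw [iteratedDeriv_succ, ih]
      ext y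
      have e : HasDerivAt (fun y : ℝ => Complex.I * y) Complex.I y := by
        simpa using (Complex.ofRealCLM.hasDerivAt (x := y)).const_mul Complex.I
      rw [(e.cexp.const_mul (Complex.I ^ n)).deriv]
      ring
  rw [norm_iteratedFDeriv_eq_norm_iteratedDeriv, this]
  simp

lemma temperate_phase (c : ℝ) :
    Function.HasTemperateGrowth (fun x : ℝ => Complex.exp (Complex.I * (c * x ^ 2 : ℝ))) := by
  have h : Function.HasTemperateGrowth (fun x : ℝ => c * x ^ 2) :=
    (Function.HasTemperateGrowth.const c).mul (Function.HasTemperateGrowth.id'.pow 2)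
  exact temperate_cexp.comp h

lemma freeProp_schwartz (hbar : ℝ) (a : SchwartzMap ℝ ℂ) (t s : ℝ) :
    (𝓕⁻ (SchwartzMap.smulLeftCLM ℂ (fun x : ℝ =>
      Complex.exp (Complex.I * ((t * (hbar * (2 * Real.pi) ^ 2 / 2)) * x ^ 2 : ℝ))) (𝓕 a)) :
        SchwartzMap ℝ ℂ) s = freeProp hbar a t s := by
  rw [freeProp_eq, SchwartzMap.fourierInv_coe, Real.fourierInv_eq']
  congr 1 with η
  rw [SchwartzMap.smulLeftCLM_apply_apply (temperate_phase _)]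
  rw [smul_eq_mul, smul_eq_mul, ← mul_assoc, ← mul_assoc, mul_comm (Complex.exp _)]
  congr 3
  · push_cast; ring
  · simp; ring

lemma freeProp_smooth (hbar : ℝ) (a : SchwartzMap ℝ ℂ) :
    ContDiff ℝ (⊤ : ℕ∞) (fun w : ℝ × ℝ => freeProp hbar (⇑a) w.1 w.2) := by
  set K := hbar * (2 * Real.pi) ^ 2 / 2 with hK
  let ι : ℝ → ℝ × ℝ := fun η => (η ^ 2, η)
  have hι : Measurable ι := by fun_prop
  let L : (ℝ × ℝ) →L[ℝ] (ℝ × ℝ) →L[ℝ] ℝ :=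
    (-(K / (2 * Real.pi))) • (ContinuousLinearMap.mul ℝ ℝ).bilinearComp
      (ContinuousLinearMap.fst ℝ ℝ ℝ) (ContinuousLinearMap.fst ℝ ℝ ℝ)
    - (ContinuousLinearMap.mul ℝ ℝ).bilinearComp
      (ContinuousLinearMap.snd ℝ ℝ ℝ) (ContinuousLinearMap.snd ℝ ℝ ℝ)
  have key := VectorFourier.contDiff_fourierIntegral (N := ⊤) L
    (μ := Measure.map ι volume) (f := fun v : ℝ × ℝ => (𝓕 a) v.2) ?_
  · have hfun : (fun w : ℝ × ℝ => freeProp hbar (⇑a) w.1 w.2) = VectorFourier.fourierIntegral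
        Real.fourierChar (Measure.map ι volume) L.toLinearMap₁₂ (fun v : ℝ × ℝ => (𝓕 a) v.2) := ?_
    · rw [hfun]; exact key
    funext w
    rw [freeProp_eq]
    unfold VectorFourier.fourierIntegral
    rw [integral_map hι.aemeasurable]
    · congr 1 with η
      rw [← mul_assoc, ← Complex.exp_add, Circle.smul_def, Real.fourierChar_apply, smul_eq_mul]
      congr 2
      simp only [L, ι]
      simp
      rw [hK]
      push_cast
      have : (Real.pi : ℂ) ≠ 0 := by exact_mod_cast Real.pi_ne_zero
      field_simp
      ring
    · apply Continuous.aestronglyMeasurable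
      have := (𝓕 a).continuous
      have hL : Continuous fun v => L v w := by fun_prop
      have hc : Continuous fun v => Real.fourierChar (-(L v w)) :=
        Real.continuous_fourierChar.comp hL.neg
      exact hc.smul (this.comp continuous_snd)
  · intro n _
    have hc := (𝓕 a).continuous
    rw [integrable_map_measure (Continuous.aestronglyMeasurable (by fun_prop)) hι.aemeasurable]
    refine (((𝓕 a).integrable_pow_mul volume (2 * n)).add
      ((𝓕 a).integrable_pow_mul volume n)).mono' (Continuous.aestronglyMeasurable (by
        simp only [Function.comp_def, ι]; fun_prop)) ?_
    refine Filter.Eventually.of_forall fun η => ?_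
    simp only [Function.comp, ι, Pi.add_apply, norm_mul, norm_pow, norm_norm, Prod.norm_mk]
    rw [← add_mul, pow_mul]
    gcongr
    rcases le_total (‖η‖ ^ 2) ‖η‖ with h | h
    · rw [max_eq_right h, norm_norm]; linarith [pow_nonneg (norm_nonneg η) n, pow_nonneg (pow_nonneg (norm_nonneg η) 2) n]
    · rw [max_eq_left h, norm_pow, norm_norm]; linarith [pow_nonneg (norm_nonneg η) n, pow_nonneg (pow_nonneg (norm_nonneg η) 2) n]

lemma integrable_aux (a : SchwartzMap ℝ ℂ) (n : ℕ) (c : ℂ) (f : ℝ → ℂ) (hf : Continuous f)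
    (h : ∀ η, ‖f η‖ = ‖c‖ * (‖η‖ ^ n * ‖a η‖)) : Integrable f :=
  ((a.integrable_pow_mul volume n).const_mul ‖c‖).mono' hf.aestronglyMeasurable
    (Filter.Eventually.of_forall fun η => (h η).le)

lemma freeProp_pde (hbar : ℝ) (a : SchwartzMap ℝ ℂ) (t s : ℝ) :
      Complex.I * deriv (fun τ : ℝ => freeProp hbar (⇑a) τ s) t =
        ((hbar : ℂ) / 2) * iteratedDeriv 2 (fun σ : ℝ => freeProp hbar (⇑a) t σ) s := by
  have hc := (𝓕 a).continuous
  have e1 := deriv_phase_integral (fun η => hbar * (2 * Real.pi) ^ 2 / 2 * η ^ 2)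
    (fun η => Complex.exp (Complex.I * s * (2 * Real.pi * η : ℝ)) * (𝓕 a) η)
    (by fun_prop) (by fun_prop)
    (integrable_aux (𝓕 a) 0 1 _ (by fun_prop) (fun η => by simp only [norm_mul, norm_cexp_phase]; simp))
    (integrable_aux (𝓕 a) 2 (hbar * (2 * Real.pi) ^ 2 / 2 : ℝ) _ (by fun_prop) (fun η => by
      simp only [norm_mul, norm_cexp_phase]; simp only [norm_mul, Complex.ofReal_mul, Complex.ofReal_pow, norm_pow,
        Complex.norm_real]; ring)) t
  have e2 := fun s => deriv_phase_integral (fun η => 2 * Real.pi * η)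
    (fun η => Complex.exp (Complex.I * t * (hbar * (2 * Real.pi) ^ 2 / 2 * η ^ 2 : ℝ)) * (𝓕 a) η)
    (by fun_prop) (by fun_prop)
    (integrable_aux (𝓕 a) 0 1 _ (by fun_prop) (fun η => by simp only [norm_mul, norm_cexp_phase]; simp))
    (integrable_aux (𝓕 a) 1 (2 * Real.pi : ℝ) _ (by fun_prop) (fun η => by
      simp only [norm_mul, norm_cexp_phase]; simp only [norm_mul, Complex.ofReal_mul, Complex.norm_real]; ring)) s
  have e3 := deriv_phase_integral (fun η => 2 * Real.pi * η)
    (fun η => Complex.I * (2 * Real.pi * η : ℝ) *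
      (Complex.exp (Complex.I * t * (hbar * (2 * Real.pi) ^ 2 / 2 * η ^ 2 : ℝ)) * (𝓕 a) η))
    (by fun_prop) (by fun_prop)
    (integrable_aux (𝓕 a) 1 (2 * Real.pi : ℝ) _ (by fun_prop) (fun η => by
      simp only [norm_mul, norm_cexp_phase]; simp only [norm_mul, Complex.ofReal_mul, Complex.norm_real, Complex.norm_I]
      ring))
    (integrable_aux (𝓕 a) 2 ((2 * Real.pi) ^ 2 : ℝ) _ (by fun_prop) (fun η => by
      simp only [norm_mul, norm_cexp_phase]; simp only [norm_mul, Complex.ofReal_mul, Complex.ofReal_pow, norm_pow,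
        Complex.norm_real, Complex.norm_I]; ring)) s
  have f1 : (fun τ : ℝ => freeProp hbar (⇑a) τ s) = _ := funext fun τ => freeProp_eq hbar a τ s
  have f2 : (fun σ : ℝ => freeProp hbar (⇑a) t σ) = fun σ : ℝ => ∫ η : ℝ,
      Complex.exp (Complex.I * σ * (2 * Real.pi * η : ℝ)) *
      (Complex.exp (Complex.I * t * (hbar * (2 * Real.pi) ^ 2 / 2 * η ^ 2 : ℝ)) * (𝓕 a) η) := by
    funext σ
    rw [freeProp_eq]
    congr 1 with η
    ring
  rw [f1, f2, e1.deriv, iteratedDeriv_succ, iteratedDeriv_one, funext fun s => (e2 s).deriv,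
    e3.deriv, ← integral_const_mul, ← integral_const_mul]
  congr 1 with η
  push_cast
  ring

/-- for Schwartz `a`, `u(t) := 𝐹⁻¹(ξ ↦ e^{itℏξ²/2}(𝐹a)(ξ))` is Schwartz for every
`t`, `(t,s) ↦ u(t)(s)` is smooth, `u(0) = a`, and `u` solves the free Schrödinger equation
`i ∂_t u = (ℏ/2) ∂²_s u`. -/
theorem freeProp_schwartz_smooth_solves (hbar : ℝ) (hhbar : 0 < hbar)
    (a : SchwartzMap ℝ ℂ) :
    (∀ t : ℝ, ∃ v : SchwartzMap ℝ ℂ, ∀ s, v s = freeProp hbar (⇑a) t s) ∧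
    ContDiff ℝ (⊤ : ℕ∞) (fun w : ℝ × ℝ => freeProp hbar (⇑a) w.1 w.2) ∧
    (∀ s, freeProp hbar (⇑a) 0 s = a s) ∧
    (∀ t s : ℝ,
      Complex.I * deriv (fun τ : ℝ => freeProp hbar (⇑a) τ s) t =
        ((hbar : ℂ) / 2) * iteratedDeriv 2 (fun σ : ℝ => freeProp hbar (⇑a) t σ) s) := by
  refine ⟨fun t => ⟨_, fun s => freeProp_schwartz hbar a t s⟩, freeProp_smooth hbar a,
    fun s => ?_, freeProp_pde hbar a⟩
  rw [← freeProp_schwartz]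
  have : SchwartzMap.smulLeftCLM ℂ (fun x : ℝ =>
      Complex.exp (Complex.I * ((0 * (hbar * (2 * Real.pi) ^ 2 / 2)) * x ^ 2 : ℝ))) (𝓕 a) = 𝓕 a := by
    ext η
    rw [SchwartzMap.smulLeftCLM_apply_apply (temperate_phase _)]
    simp
  rw [this, FourierTransform.fourierInv_fourier_eq]
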